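/- For all real numbers b_min, b_max, b, ρ with 0 < b_min ≤ b_max, b > 0 and ρ ≥ 1, there exists a constant K > 0 such that the following holds for all positive integers N, T with N ≤ ρ·T and T ≤ ρ·N and all weights h_{it} with b_min ≤ h_{it} ≤ b_max (i = 1,…,N; t = 1,…,T): the matrix H̄ := (NT)^{-1/2}·(M + b·v vᵀ) is invertible, and every entry of H̄^{-1} − D^{-1} is at most K·(NT)^{-1/2} in absolute value, where D := (NT)^{-1/2}·diag(Σ_t h_{1t},…,Σ_t h_{Nt}, Σ_i h_{i1},…,Σ_i h_{iT}). In other words, the inverse of the expected incidental-parameter Hessian is uniformly approximated, in the entrywise maximum norm and up to order (NT)^{-1/2}, by the inverse of its diagonal blocks without penalty. -/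

import Mathlib

open Matrix

/-- The penalized expected incidental-parameter Hessian
`H̄ = (NT)^{-1/2}·(M + b·v vᵀ)` with `v = (1_N', −1_T')'`. -/
noncomputable def Hbar {N T : ℕ} (w : Fin N → Fin T → ℝ) (b : ℝ) :
    Matrix (Fin N ⊕ Fin T) (Fin N ⊕ Fin T) ℝ :=
  (Real.sqrt ((N : ℝ) * T))⁻¹ •
    (Matrix.fromBlocks (Matrix.diagonal fun i => ∑ t, w i t) (Matrix.of fun i t => w i t)
        (Matrix.of fun t i => w i t) (Matrix.diagonal fun t => ∑ i, w i t)
      + b • Matrix.vecMulVec (Sum.elim (fun _ => (1 : ℝ)) fun _ => -1)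
          (Sum.elim (fun _ => (1 : ℝ)) fun _ => -1))

/-- The vector `𝒳 = (NT)^{-1}·(X 1_T ; Xᵀ 1_N)` associated to an `N×T` matrix `X`. -/
noncomputable def scoreVec {N T : ℕ} (X : Matrix (Fin N) (Fin T) ℝ) :
    Fin N ⊕ Fin T → ℝ :=
  ((N : ℝ) * T)⁻¹ • Sum.elim (fun i => ∑ t, X i t) fun t => ∑ i, X i t

/-- The diagonal matrix `D = (NT)^{-1/2}·diag(Σ_t h_{1t},…,Σ_t h_{Nt},Σ_i h_{i1},…,Σ_i h_{iT})`
of the unpenalized Hessian blocks. -/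
noncomputable def Dmat {N T : ℕ} (w : Fin N → Fin T → ℝ) :
    Matrix (Fin N ⊕ Fin T) (Fin N ⊕ Fin T) ℝ :=
  (Real.sqrt ((N : ℝ) * T))⁻¹ •
    Matrix.diagonal (Sum.elim (fun i => ∑ t, w i t) fun t => ∑ i, w i t)

/-- A vector solving `A z = r` is bounded entrywise when `A` is an entrywise bounded perturbation
of a diagonal matrix and its quadratic form dominates the squared `ℓ¹` norm. -/
theorem abs_apply_le_of_mulVec_bound {ι : Type*} [Fintype ι] [DecidableEq ι]
    {A : Matrix ι ι ℝ} {d z : ι → ℝ} {C δ κ R : ℝ} (hC : 0 ≤ C) (hδ : 0 < δ) (hκ : 0 < κ)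
    (hR : 0 ≤ R) (hA : ∀ i j, |(A - diagonal d) i j| ≤ C) (hd : ∀ i, δ ≤ d i)
    (hQ : ∀ x : ι → ℝ, κ * (∑ i, |x i|) ^ 2 ≤ x ⬝ᵥ (A *ᵥ x))
    (hz : ∀ i, |(A *ᵥ z) i| ≤ R) (i : ι) : |z i| ≤ R * (1 + C / κ) / δ := by
  set L := ∑ i, |z i| with hL
  have hL0 : 0 ≤ L := Finset.sum_nonneg fun i _ => abs_nonneg _
  have hform : z ⬝ᵥ (A *ᵥ z) ≤ R * L := by
    rw [hL, Finset.mul_sum]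
    refine Finset.sum_le_sum fun j _ => (le_abs_self _).trans ?_
    rw [abs_mul, mul_comm]
    exact mul_le_mul_of_nonneg_right (hz j) (abs_nonneg _)
  have hLR : L ≤ R / κ := by
    rw [le_div_iff₀ hκ]
    by_contra! hlt
    have hpos : 0 < L := by
      rcases hL0.lt_or_eq with h | h
      · exact h
      · rw [← h] at hlt; linarith
    nlinarith [hQ z, mul_lt_mul_of_pos_right hlt hpos]
  have hrest : |((A - diagonal d) *ᵥ z) i| ≤ C * L := by
    rw [hL, Finset.mul_sum]
    refine (Finset.abs_sum_le_sum_abs _ _).trans (Finset.sum_le_sum fun j _ => ?_)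
    rw [abs_mul]
    exact mul_le_mul_of_nonneg_right (hA i j) (abs_nonneg _)
  have hdz : d i * z i = (A *ᵥ z) i - ((A - diagonal d) *ᵥ z) i := by
    rw [Matrix.sub_mulVec, Pi.sub_apply, Matrix.mulVec_diagonal]; ring
  have hdi : 0 < d i := hδ.trans_le (hd i)
  have hbound : d i * |z i| ≤ R + C * L := by
    rw [← abs_of_pos hdi, ← abs_mul, hdz]
    exact (abs_sub _ _).trans (add_le_add (hz i) hrest)
  rw [le_div_iff₀ hδ]
  calc |z i| * δ ≤ d i * |z i| := by
        rw [mul_comm]; exact mul_le_mul_of_nonneg_right (hd i) (abs_nonneg _)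
    _ ≤ R + C * L := hbound
    _ ≤ R + C * (R / κ) := by gcongr
    _ = R * (1 + C / κ) := by ring

/-- A square matrix whose quadratic form dominates the squared `ℓ¹` norm is invertible. -/
theorem isUnit_of_sq_sum_abs_le_quadratic {ι : Type*} [Fintype ι] [DecidableEq ι]
    {A : Matrix ι ι ℝ} {κ : ℝ} (hκ : 0 < κ)
    (hQ : ∀ x : ι → ℝ, κ * (∑ i, |x i|) ^ 2 ≤ x ⬝ᵥ (A *ᵥ x)) : IsUnit A := by
  rw [← Matrix.mulVec_injective_iff_isUnit]
  refine (injective_iff_map_eq_zero (Matrix.mulVecLin A)).2 fun x hx => ?_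
  have h := hQ x
  rw [← Matrix.mulVecLin_apply, hx, dotProduct_zero] at h
  have hsq : (∑ i, |x i|) ^ 2 ≤ 0 := nonpos_of_mul_nonpos_right h hκ
  have hsum : ∑ i, |x i| = 0 := by
    simpa using le_antisymm hsq (sq_nonneg _)
  funext i
  exact abs_eq_zero.1
    ((Finset.sum_eq_zero_iff_of_nonneg fun j _ => abs_nonneg (x j)).1 hsum i (Finset.mem_univ i))

/-- The inverse of an entrywise bounded perturbation of a diagonal matrix is entrywise close to
the inverse of the diagonal matrix when the quadratic form dominates the squared `ℓ¹` norm. -/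
theorem abs_inv_sub_inv_diagonal_apply_le {ι : Type*} [Fintype ι] [DecidableEq ι]
    {A : Matrix ι ι ℝ} {d : ι → ℝ} {C δ κ : ℝ} (hC : 0 ≤ C) (hδ : 0 < δ) (hκ : 0 < κ)
    (hA : ∀ i j, |(A - diagonal d) i j| ≤ C) (hd : ∀ i, δ ≤ d i)
    (hQ : ∀ x : ι → ℝ, κ * (∑ i, |x i|) ^ 2 ≤ x ⬝ᵥ (A *ᵥ x)) (i j : ι) :
    |(A⁻¹ - (diagonal d)⁻¹) i j| ≤ C * (1 + C / κ) / δ ^ 2 := by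
  have hAdet := (Matrix.isUnit_iff_isUnit_det A).1 (isUnit_of_sq_sum_abs_le_quadratic hκ hQ)
  have hd0 : ∀ i, 0 < d i := fun i => hδ.trans_le (hd i)
  have hinv : (diagonal d)⁻¹ = diagonal fun i => (d i)⁻¹ := by
    refine Matrix.inv_eq_right_inv ?_
    simp [Matrix.diagonal_mul_diagonal, fun i => mul_inv_cancel₀ (hd0 i).ne']
  have hmul : A * (A⁻¹ - (diagonal d)⁻¹) = -((A - diagonal d) * (diagonal d)⁻¹) := by
    have h1 : diagonal d * (diagonal d)⁻¹ = 1 := by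
      rw [hinv]
      simp [Matrix.diagonal_mul_diagonal, fun i => mul_inv_cancel₀ (hd0 i).ne']
    rw [mul_sub, sub_mul, h1, Matrix.mul_nonsing_inv _ hAdet]; abel
  have hcol : ∀ k, |(A *ᵥ fun l => (A⁻¹ - (diagonal d)⁻¹) l j) k| ≤ C / δ := by
    intro k
    change |(A * (A⁻¹ - (diagonal d)⁻¹)) k j| ≤ C / δ
    rw [hmul, hinv, Matrix.neg_apply, abs_neg, Matrix.mul_diagonal, abs_mul, abs_inv,
      abs_of_pos (hd0 j), ← div_eq_mul_inv]
    exact div_le_div₀ hC (hA k j) hδ (hd j)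
  refine (abs_apply_le_of_mulVec_bound hC hδ hκ (by positivity) hA hd hQ hcol i).trans_eq ?_
  field_simp

/-- The additive two-way interactions and the penalty jointly control the squared `ℓ¹` norm. -/
theorem sq_sum_abs_le_two_way {N T : ℕ} {ρ : ℝ} (hρ : 0 ≤ ρ) (hNT : (N : ℝ) ≤ ρ * T)
    (hTN : (T : ℝ) ≤ ρ * N) (x : Fin N ⊕ Fin T → ℝ) :
    (∑ g, |x g|) ^ 2 ≤ (1 + ρ) * (∑ i, ∑ t, (x (Sum.inl i) + x (Sum.inr t)) ^ 2
      + (∑ i, x (Sum.inl i) - ∑ t, x (Sum.inr t)) ^ 2) := by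
  have hcs : (∑ g, |x g|) ^ 2 ≤ ((N : ℝ) + T) * ∑ g, x g ^ 2 := by
    have h := sq_sum_le_card_mul_sum_sq (s := Finset.univ) (f := fun g => |x g|)
    simpa [sq_abs] using h
  have hexp : ∑ i, ∑ t, (x (Sum.inl i) + x (Sum.inr t)) ^ 2
      = T * ∑ i, x (Sum.inl i) ^ 2 + N * ∑ t, x (Sum.inr t) ^ 2
        + 2 * ((∑ i, x (Sum.inl i)) * ∑ t, x (Sum.inr t)) := by
    rw [Finset.sum_mul_sum]
    simp only [add_sq, Finset.sum_add_distrib, Finset.sum_const, Finset.card_univ,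
      Fintype.card_fin, nsmul_eq_mul, Finset.mul_sum]
    simp only [mul_assoc]
    ring
  have h1 : 0 ≤ ∑ i, x (Sum.inl i) ^ 2 := Finset.sum_nonneg fun i _ => sq_nonneg _
  have h2 : 0 ≤ ∑ t, x (Sum.inr t) ^ 2 := Finset.sum_nonneg fun i _ => sq_nonneg _
  rw [Fintype.sum_sum_type (fun g => x g ^ 2)] at hcs
  rw [hexp]
  have h3 : ((N : ℝ) + T) * ∑ i, x (Sum.inl i) ^ 2
      ≤ (1 + ρ) * T * ∑ i, x (Sum.inl i) ^ 2 :=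
    mul_le_mul_of_nonneg_right (by linarith) h1
  have h4 : ((N : ℝ) + T) * ∑ t, x (Sum.inr t) ^ 2
      ≤ (1 + ρ) * N * ∑ t, x (Sum.inr t) ^ 2 :=
    mul_le_mul_of_nonneg_right (by linarith) h2
  have h5 : 0 ≤ (1 + ρ) * ((∑ i, x (Sum.inl i)) ^ 2 + (∑ t, x (Sum.inr t)) ^ 2) := by
    positivity
  linarith

/-- The Hessian before the `(NT)^{-1/2}` normalization, with penalty `b`. -/
noncomputable def unscaledHessian {N T : ℕ} (w : Fin N → Fin T → ℝ) (b : ℝ) :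
    Matrix (Fin N ⊕ Fin T) (Fin N ⊕ Fin T) ℝ :=
  Matrix.fromBlocks (Matrix.diagonal fun i => ∑ t, w i t) (Matrix.of fun i t => w i t)
      (Matrix.of fun t i => w i t) (Matrix.diagonal fun t => ∑ i, w i t)
    + b • Matrix.vecMulVec (Sum.elim (fun _ => (1 : ℝ)) fun _ => -1)
        (Sum.elim (fun _ => (1 : ℝ)) fun _ => -1)

/-- The quadratic form of the unscaled Hessian. -/
theorem dotProduct_unscaledHessian_mulVec {N T : ℕ} (w : Fin N → Fin T → ℝ) (b : ℝ)
    (x : Fin N ⊕ Fin T → ℝ) :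
    x ⬝ᵥ (unscaledHessian w b *ᵥ x)
      = ∑ i, ∑ t, w i t * (x (Sum.inl i) + x (Sum.inr t)) ^ 2
        + b * (∑ i, x (Sum.inl i) - ∑ t, x (Sum.inr t)) ^ 2 := by
  have hpen : x ⬝ᵥ ((b • Matrix.vecMulVec (Sum.elim (fun _ : Fin N => (1 : ℝ))
      fun _ : Fin T => -1) (Sum.elim (fun _ => (1 : ℝ)) fun _ => -1)) *ᵥ x)
      = b * (∑ i, x (Sum.inl i) - ∑ t, x (Sum.inr t)) ^ 2 := by
    rw [Matrix.smul_mulVec, Matrix.vecMulVec_mulVec, dotProduct_smul]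
    simp [dotProduct, Fintype.sum_sum_type, Finset.sum_neg_distrib, ← Finset.sum_mul]
    exact Or.inl (by ring)
  rw [unscaledHessian, Matrix.add_mulVec, dotProduct_add, hpen, Matrix.fromBlocks_mulVec]
  congr 1
  have hw : ∑ t, ∑ i, w i t * x (Sum.inr t) ^ 2 = ∑ i, ∑ t, w i t * x (Sum.inr t) ^ 2 :=
    Finset.sum_comm
  have hw' : ∑ t, ∑ i, w i t * (x (Sum.inl i) * x (Sum.inr t))
      = ∑ i, ∑ t, w i t * (x (Sum.inl i) * x (Sum.inr t)) := Finset.sum_comm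
  have hl : x ⬝ᵥ Sum.elim
      (diagonal (fun i => ∑ t, w i t) *ᵥ (x ∘ Sum.inl)
        + (of fun i t => w i t) *ᵥ (x ∘ Sum.inr))
      ((of fun t i => w i t) *ᵥ (x ∘ Sum.inl)
        + diagonal (fun t => ∑ i, w i t) *ᵥ (x ∘ Sum.inr))
      = ∑ i, ∑ t, w i t * x (Sum.inl i) ^ 2
        + ∑ i, ∑ t, w i t * (x (Sum.inl i) * x (Sum.inr t))
        + (∑ t, ∑ i, w i t * (x (Sum.inl i) * x (Sum.inr t))
          + ∑ t, ∑ i, w i t * x (Sum.inr t) ^ 2) := by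
    simp only [dotProduct, Fintype.sum_sum_type, Sum.elim_inl, Sum.elim_inr, Pi.add_apply,
      Matrix.mulVec_diagonal, Function.comp_apply, ← Finset.sum_add_distrib]
    congr 1
    · refine Finset.sum_congr rfl fun i _ => ?_
      simp only [Matrix.mulVec, dotProduct, of_apply, Finset.sum_mul, Finset.mul_sum, mul_add,
        Function.comp_apply, ← Finset.sum_add_distrib]
      exact Finset.sum_congr rfl fun t _ => by ring
    · refine Finset.sum_congr rfl fun i _ => ?_
      simp only [Matrix.mulVec, dotProduct, of_apply, Finset.sum_mul, Finset.mul_sum, mul_add,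
        Function.comp_apply, ← Finset.sum_add_distrib]
      exact Finset.sum_congr rfl fun t _ => by ring
  rw [hl, hw, hw']
  simp only [← Finset.sum_add_distrib]
  exact Finset.sum_congr rfl fun i _ => Finset.sum_congr rfl fun t _ => by ring

/-- The unscaled Hessian differs from its unpenalized diagonal by an entrywise bounded matrix. -/
theorem abs_unscaledHessian_sub_diagonal_le {N T : ℕ} {w : Fin N → Fin T → ℝ} {b B : ℝ}
    (hb : 0 ≤ b) (hB : 0 ≤ B) (hw : ∀ i t, |w i t| ≤ B) (g g' : Fin N ⊕ Fin T) :
    |(unscaledHessian w b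
      - diagonal (Sum.elim (fun i => ∑ t, w i t) fun t => ∑ i, w i t)) g g'| ≤ B + b := by
  have hcross : ∀ i t, |w i t + -b| ≤ B + b := fun i t =>
    (abs_add_le _ _).trans (by rw [abs_neg, abs_of_nonneg hb]; linarith [hw i t])
  rw [← Matrix.fromBlocks_diagonal, unscaledHessian]
  rcases g with i | t <;> rcases g' with i' | t'
  · simpa [Matrix.vecMulVec_apply, abs_of_nonneg hb, -Matrix.fromBlocks_diagonal] using hB
  · simpa [Matrix.vecMulVec_apply] using hcross i t'
  · simpa [Matrix.vecMulVec_apply] using hcross i' t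
  · simpa [Matrix.vecMulVec_apply, abs_of_nonneg hb, -Matrix.fromBlocks_diagonal] using hB

/-- For fixed `0 < b_min ≤ b_max`, `b > 0` and aspect-ratio bound `ρ ≥ 1`, there is a
constant `K > 0` such that uniformly over panels with `N ≤ ρT`, `T ≤ ρN` and weights
`b_min ≤ h_{it} ≤ b_max`, the penalized Hessian `H̄` is invertible and every entry of
`H̄⁻¹ − D⁻¹` is at most `K·(NT)^{-1/2}` in absolute value. -/
theorem inverse_hessian_uniform_diagonal_approximation
    (bmin bmax b ρ : ℝ) (hbmin : 0 < bmin) (hbb : bmin ≤ bmax) (hb : 0 < b) (hρ : 1 ≤ ρ) :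
    ∃ K : ℝ, 0 < K ∧ ∀ (N T : ℕ), 0 < N → 0 < T →
      (N : ℝ) ≤ ρ * T → (T : ℝ) ≤ ρ * N →
      ∀ w : Fin N → Fin T → ℝ,
        (∀ i t, bmin ≤ w i t) → (∀ i t, w i t ≤ bmax) →
        IsUnit (Hbar w b) ∧
          ∀ (g g' : Fin N ⊕ Fin T),
            |((Hbar w b)⁻¹ - (Dmat w)⁻¹) g g'| ≤ K * (Real.sqrt ((N : ℝ) * T))⁻¹ := by
  have hρ0 : 0 < 1 + ρ := by linarith
  have hbmax : 0 < bmax := hbmin.trans_le hbb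
  obtain ⟨c, hc, hcmin, hcb⟩ : ∃ c : ℝ, 0 < c ∧ c ≤ bmin ∧ c ≤ b :=
    ⟨min bmin b, lt_min hbmin hb, min_le_left _ _, min_le_right _ _⟩
  set C := bmax + b
  set κ := c / (1 + ρ) with hκdef
  have hC : 0 < C := by positivity
  have hκ : 0 < κ := by positivity
  refine ⟨C * (1 + C / κ) * ρ / bmin ^ 2, by positivity, ?_⟩
  intro N T hN hT hNT hTN w hwl hwu
  have hN' : (0 : ℝ) < N := by exact_mod_cast hN
  have hT' : (0 : ℝ) < T := by exact_mod_cast hT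
  set s := Real.sqrt ((N : ℝ) * T)
  have hs0 : 0 < s := Real.sqrt_pos.2 (by positivity)
  have hs2 : s ^ 2 = N * T := Real.sq_sqrt (by positivity)
  set d : Fin N ⊕ Fin T → ℝ := Sum.elim (fun i => ∑ t, w i t) fun t => ∑ i, w i t
  set q := min (N : ℝ) T with hq
  have hq0 : 0 < q := lt_min hN' hT'
  have hqs : s ^ 2 ≤ ρ * q ^ 2 := by
    rw [hs2]
    rcases min_cases (N : ℝ) T with ⟨h, _⟩ | ⟨h, _⟩ <;> rw [hq, h] <;> nlinarith
  have hdl : ∀ g, bmin * q ≤ d g := by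
    rintro (i | t)
    · have h := Finset.card_nsmul_le_sum Finset.univ (w i) bmin fun t _ => hwl i t
      rw [Finset.card_univ, Fintype.card_fin, nsmul_eq_mul] at h
      have := mul_le_mul_of_nonneg_left (min_le_right (N : ℝ) T) hbmin.le
      change bmin * q ≤ ∑ t, w i t
      linarith
    · have h := Finset.card_nsmul_le_sum Finset.univ (fun i => w i t) bmin fun i _ => hwl i t
      rw [Finset.card_univ, Fintype.card_fin, nsmul_eq_mul] at h
      have := mul_le_mul_of_nonneg_left (min_le_left (N : ℝ) T) hbmin.le
      change bmin * q ≤ ∑ i, w i t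
      linarith
  have hQ : ∀ x : Fin N ⊕ Fin T → ℝ,
      κ * (∑ g, |x g|) ^ 2 ≤ x ⬝ᵥ (unscaledHessian w b *ᵥ x) := by
    intro x
    calc κ * (∑ g, |x g|) ^ 2
        ≤ κ * ((1 + ρ) * (∑ i, ∑ t, (x (Sum.inl i) + x (Sum.inr t)) ^ 2
          + (∑ i, x (Sum.inl i) - ∑ t, x (Sum.inr t)) ^ 2)) :=
          mul_le_mul_of_nonneg_left (sq_sum_abs_le_two_way (by linarith) hNT hTN x) hκ.le
      _ = ∑ i, ∑ t, c * (x (Sum.inl i) + x (Sum.inr t)) ^ 2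
          + c * (∑ i, x (Sum.inl i) - ∑ t, x (Sum.inr t)) ^ 2 := by
          simp only [← Finset.mul_sum]
          rw [hκdef]
          field_simp
      _ ≤ _ := by
          rw [dotProduct_unscaledHessian_mulVec]
          gcongr with i _ t _
          exact hcmin.trans (hwl i t)
  have hA := abs_unscaledHessian_sub_diagonal_le (w := w) hb.le hbmax.le fun i t =>
    abs_le.2 ⟨by linarith [hwl i t], hwu i t⟩
  have hunit := isUnit_of_sq_sum_abs_le_quadratic hκ hQ
  have hdet := (Matrix.isUnit_iff_isUnit_det _).1 hunit
  have hddet : IsUnit (diagonal d).det := by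
    rw [Matrix.det_diagonal, isUnit_iff_ne_zero]
    exact Finset.prod_ne_zero_iff.2 fun g _ => ((by positivity : 0 < bmin * q).trans_le (hdl g)).ne'
  have hH : Hbar w b = (Units.mk0 s hs0.ne')⁻¹ • unscaledHessian w b := rfl
  have hD : Dmat w = (Units.mk0 s hs0.ne')⁻¹ • diagonal d := rfl
  refine ⟨by rw [hH]; exact hunit.smul _, fun g g' => ?_⟩
  rw [hH, hD, Matrix.inv_smul' _ _ hdet, Matrix.inv_smul' _ _ hddet, inv_inv, ← smul_sub,
    Matrix.smul_apply, Units.smul_mk0, smul_eq_mul, abs_mul, abs_of_pos hs0]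
  calc s * |((unscaledHessian w b)⁻¹ - (diagonal d)⁻¹) g g'|
      ≤ s * (C * (1 + C / κ) / (bmin * q) ^ 2) :=
        mul_le_mul_of_nonneg_left (abs_inv_sub_inv_diagonal_apply_le hC.le (by positivity) hκ
          hA hdl hQ g g') hs0.le
    _ = C * (1 + C / κ) / bmin ^ 2 * (s ^ 2 / q ^ 2) * s⁻¹ := by field_simp
    _ ≤ C * (1 + C / κ) / bmin ^ 2 * ρ * s⁻¹ := by
        gcongr
        exact (div_le_iff₀ (by positivity)).2 hqs
    _ = C * (1 + C / κ) * ρ / bmin ^ 2 * s⁻¹ := by ring
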